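/- Let (W_S, S) be a Coxeter system and A_S the corresponding Artin-Tits group. Let Y_1, Y_2 ⊆ S and let w ∈ W_S satisfy w⁻¹Y_1w = Y_2. Then for every reduced expression w = s_{i_1}⋯s_{i_l}, the element a = σ_{i_1}⋯σ_{i_l} of A_S satisfies a⁻¹σ_y a = σ_{w⁻¹yw} for all y ∈ Y_1. -/

import Mathlib

namespace ArtinTits

variable {B : Type*}

/-- The alternating product `a b a b ⋯` with `m` factors, starting with `a`. -/
def altProd {G : Type*} [Monoid G] (a b : G) : ℕ → G
  | 0 => 1
  | n + 1 => a * altProd b a n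

/-- The braid relations defining the Artin–Tits group of a Coxeter matrix:
`Π(σ_s, σ_t; m_{s,t}) = Π(σ_t, σ_s; m_{s,t})` whenever `m_{s,t} ≠ ∞` (here `∞` is coded by `0`). -/
def artinRelationsSet (M : CoxeterMatrix B) : Set (FreeGroup B) :=
  {r | ∃ s t : B, M s t ≠ 0 ∧
    r = altProd (FreeGroup.of s) (FreeGroup.of t) (M s t) *
        (altProd (FreeGroup.of t) (FreeGroup.of s) (M s t))⁻¹}

/-- The Artin–Tits group of a Coxeter matrix. -/
abbrev ArtinGroup (M : CoxeterMatrix B) : Type _ := PresentedGroup (artinRelationsSet M)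

/-- The standard generator `σ_s` of the Artin–Tits group. -/
def σ (M : CoxeterMatrix B) (s : B) : ArtinGroup M := PresentedGroup.of s

/-- The standard parabolic subgroup `A_X` of the Artin–Tits group. -/
def AP (M : CoxeterMatrix B) (X : Set B) : Subgroup (ArtinGroup M) :=
  Subgroup.closure (σ M '' X)

/-- The standard parabolic subgroup `W_X` of the Coxeter group. -/
def WP (M : CoxeterMatrix B) (X : Set B) : Subgroup M.Group :=
  Subgroup.closure (M.simple '' X)

/-- A subgroup `H ≤ G` is conjugacy stable if any two elements of `H` which are conjugate
in `G` are already conjugate by an element of `H`. -/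
def IsConjugacyStable {G : Type*} [Group G] (H : Subgroup G) : Prop :=
  ∀ a b : G, a ∈ H → b ∈ H → (∃ g : G, g⁻¹ * a * g = b) → ∃ h ∈ H, h⁻¹ * a * h = b

/-- Property `⋆_W` for the pair `(W_X, W_S)`. -/
def StarW (M : CoxeterMatrix B) (X : Set B) : Prop :=
  ∀ Y₁ Y₂ : Set B, Y₁ ⊆ X → Y₂ ⊆ X → ∀ w : M.Group,
    (fun x => w⁻¹ * x * w) '' (M.simple '' Y₁) = M.simple '' Y₂ →
    ∃ v ∈ WP M X, ∀ y ∈ Y₁, v⁻¹ * M.simple y * v = w⁻¹ * M.simple y * w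

/-- Property `⋆_A` for the pair `(A_X, A_S)`. -/
def StarA (M : CoxeterMatrix B) (X : Set B) : Prop :=
  ∀ Y₁ Y₂ : Set B, Y₁ ⊆ X → Y₂ ⊆ X → ∀ g : ArtinGroup M,
    (fun x => g⁻¹ * x * g) '' (σ M '' Y₁) = σ M '' Y₂ →
    ∃ h ∈ AP M X, ∀ y ∈ Y₁, h⁻¹ * σ M y * h = g⁻¹ * σ M y * g

/-- Adjacency in the Coxeter graph: `s` and `t` are joined by an edge iff `m_{s,t} ≥ 3`
(where the value `0` codes `∞`, which also gives an edge). -/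
def Adj (M : CoxeterMatrix B) (s t : B) : Prop := s ≠ t ∧ M s t ≠ 2

/-- `s` and `t` are connected by a path of the Coxeter graph staying inside `X`. -/
def ReachIn (M : CoxeterMatrix B) (X : Set B) (s t : B) : Prop :=
  Relation.ReflTransGen (fun a b => a ∈ X ∧ b ∈ X ∧ Adj M a b) s t

/-- The Coxeter graph induced on `X` is connected. -/
def ConnectedIn (M : CoxeterMatrix B) (X : Set B) : Prop :=
  ∀ s ∈ X, ∀ t ∈ X, ReachIn M X s t

/-- The Coxeter matrix `M` restricted to `X` is of the type of the Coxeter matrix `M'`,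
i.e. there is a bijection transporting one to the other. -/
def IsOfType {B' : Type*} (M : CoxeterMatrix B) (X : Set B) (M' : CoxeterMatrix B') : Prop :=
  ∃ e : X ≃ B', ∀ a b : X, M a.val b.val = M' (e a) (e b)

/-- The Coxeter matrix of type `Bₙ` with the paper's labelling: vertices `0, …, n-1`
(representing `s_1, …, s_n`), `m_{s_1, s_2} = 4` and `m_{s_i, s_{i+1}} = 3` for `i ≥ 2`. -/
def Bmat (n : ℕ) : CoxeterMatrix (Fin n) where
  M := Matrix.of fun i j : Fin n ↦
    if i = j then 1
      else (if (i.val = 0 ∧ j.val = 1) ∨ (j.val = 0 ∧ i.val = 1) then 4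
        else (if (j : ℕ) + 1 = i ∨ (i : ℕ) + 1 = j then 3 else 2))
  isSymm := by unfold Matrix.IsSymm; aesop
  diagonal := by simp
  off_diagonal := by aesop

/-- The Coxeter matrix of type `Dₙ` with the paper's labelling: vertices `0, …, n-1`
(representing `s_1, …, s_n`), with edges `{s_1, s_3}`, `{s_2, s_3}` and `{s_i, s_{i+1}}`
for `i ≥ 3`, all labelled `3`. -/
def Dmat (n : ℕ) : CoxeterMatrix (Fin n) where
  M := Matrix.of fun i j : Fin n ↦
    if i = j then 1
      else (if (i.val = 0 ∧ j.val = 2) ∨ (j.val = 0 ∧ i.val = 2) then 3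
        else (if i.val = 0 ∨ j.val = 0 then 2
          else (if (j : ℕ) + 1 = i ∨ (i : ℕ) + 1 = j then 3 else 2)))
  isSymm := by unfold Matrix.IsSymm; aesop
  diagonal := by simp
  off_diagonal := by aesop

end ArtinTits

namespace ArtinTits

/-! ### The geometric representation and the order of `s t` -/

/-- Entries of twice the Gram matrix. -/
noncomputable def gram {B : Type*} (M : CoxeterMatrix B) (i j : B) : ℝ :=
  -2 * Real.cos (Real.pi / (M i j : ℝ))

noncomputable def geoForm {B : Type*} (M : CoxeterMatrix B) (i : B) : (B →₀ ℝ) →ₗ[ℝ] ℝ :=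
  Finsupp.linearCombination ℝ (gram M i)

/-- The reflection attached to `i` in the geometric representation. -/
noncomputable def geoRefl {B : Type*} (M : CoxeterMatrix B) (i : B) : Module.End ℝ (B →₀ ℝ) :=
  LinearMap.id - (geoForm M i).smulRight (Finsupp.single i 1)

lemma geoRefl_apply {B : Type*} (M : CoxeterMatrix B) (i : B) (v : B →₀ ℝ) :
    geoRefl M i v = v - geoForm M i v • Finsupp.single i 1 := by
  simp [geoRefl]

lemma geoForm_single {B : Type*} (M : CoxeterMatrix B) (i j : B) :
    geoForm M i (Finsupp.single j 1) = gram M i j := by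
  simp [geoForm]

lemma gram_self {B : Type*} (M : CoxeterMatrix B) (i : B) : gram M i i = 2 := by
  simp [gram]

lemma gram_symm {B : Type*} (M : CoxeterMatrix B) (i j : B) : gram M i j = gram M j i := by
  simp [gram, M.symmetric i j]

lemma geoRefl_mul_left {B : Type*} (M : CoxeterMatrix B) (i j : B) :
    (geoRefl M i * geoRefl M j) (Finsupp.single i 1) =
      (gram M i j ^ 2 - 1) • Finsupp.single i 1 - gram M i j • Finsupp.single j 1 := by
  simp only [Module.End.mul_apply, geoRefl_apply, map_sub, map_smul, geoForm_single, gram_self,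
    gram_symm M j i, smul_eq_mul]
  module

lemma geoRefl_mul_right {B : Type*} (M : CoxeterMatrix B) (i j : B) :
    (geoRefl M i * geoRefl M j) (Finsupp.single j 1) =
      gram M i j • Finsupp.single i 1 - Finsupp.single j 1 := by
  simp only [Module.End.mul_apply, geoRefl_apply, map_sub, map_smul, geoForm_single, gram_self,
    smul_eq_mul]
  module

lemma sin_add_two_sub (x θ : ℝ) :
    Real.sin (x + θ) = 2 * Real.cos θ * Real.sin x - Real.sin (x - θ) := by
  rw [Real.sin_add, Real.sin_sub]; ring

lemma geoRefl_pow_left {B : Type*} (M : CoxeterMatrix B) (i j : B) (n : ℕ) :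
    Real.sin (Real.pi / (M i j : ℝ)) • ((geoRefl M i * geoRefl M j) ^ n) (Finsupp.single i 1) =
      Real.sin ((2 * n + 1) * (Real.pi / (M i j : ℝ))) • Finsupp.single i 1 +
      Real.sin (2 * n * (Real.pi / (M i j : ℝ))) • Finsupp.single j 1 := by
  induction n with
  | zero => simp
  | succ n ih =>
    rw [pow_succ', Module.End.mul_apply, ← map_smul, ih, map_add, map_smul, map_smul,
      geoRefl_mul_left, geoRefl_mul_right]
    set θ := Real.pi / (M i j : ℝ) with hθ
    have hg : gram M i j = -2 * Real.cos θ := rfl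
    have e1 := sin_add_two_sub ((2 * n + 1) * θ) θ
    have e2 := sin_add_two_sub ((2 * n + 2) * θ) θ
    have a1 : (2 * (n : ℝ) + 1) * θ + θ = (2 * n + 2) * θ := by ring
    have a2 : (2 * (n : ℝ) + 1) * θ - θ = (2 * n) * θ := by ring
    have a3 : (2 * (n : ℝ) + 2) * θ + θ = (2 * n + 3) * θ := by ring
    have a4 : (2 * (n : ℝ) + 2) * θ - θ = (2 * n + 1) * θ := by ring
    rw [a1, a2] at e1
    rw [a3, a4] at e2
    have b1 : (2 * ((n + 1 : ℕ) : ℝ) + 1) * θ = (2 * n + 3) * θ := by push_cast; ring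
    have b2 : 2 * ((n + 1 : ℕ) : ℝ) * θ = (2 * n + 2) * θ := by push_cast; ring
    rw [b1, b2, e2, e1, hg]
    module

lemma geoRefl_pow_right {B : Type*} (M : CoxeterMatrix B) (i j : B) (n : ℕ) :
    Real.sin (Real.pi / (M i j : ℝ)) • ((geoRefl M i * geoRefl M j) ^ n) (Finsupp.single j 1) =
      - Real.sin (2 * n * (Real.pi / (M i j : ℝ))) • Finsupp.single i 1 -
      Real.sin ((2 * n - 1) * (Real.pi / (M i j : ℝ))) • Finsupp.single j 1 := by
  induction n with
  | zero => simp
  | succ n ih =>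
    rw [pow_succ', Module.End.mul_apply, ← map_smul, ih, map_sub, map_smul, map_smul,
      geoRefl_mul_left, geoRefl_mul_right]
    set θ := Real.pi / (M i j : ℝ) with hθ
    have hg : gram M i j = -2 * Real.cos θ := rfl
    have e1 := sin_add_two_sub ((2 * n) * θ) θ
    have e2 := sin_add_two_sub ((2 * n + 1) * θ) θ
    have a1 : (2 * (n : ℝ)) * θ + θ = (2 * n + 1) * θ := by ring
    have a2 : (2 * (n : ℝ)) * θ - θ = (2 * n - 1) * θ := by ring
    have a3 : (2 * (n : ℝ) + 1) * θ + θ = (2 * n + 2) * θ := by ring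
    have a4 : (2 * (n : ℝ) + 1) * θ - θ = (2 * n) * θ := by ring
    rw [a1, a2] at e1
    rw [a3, a4] at e2
    have b1 : (2 * ((n + 1 : ℕ) : ℝ) - 1) * θ = (2 * n + 1) * θ := by push_cast; ring
    have b2 : 2 * ((n + 1 : ℕ) : ℝ) * θ = (2 * n + 2) * θ := by push_cast; ring
    rw [b1, b2, e2, e1, hg]
    module

lemma sin_pos_of_ne {B : Type*} (M : CoxeterMatrix B) {i j : B} (h : i ≠ j) (h0 : M i j ≠ 0) :
    0 < Real.sin (Real.pi / (M i j : ℝ)) := by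
  have h1 : M i j ≠ 1 := M.off_diagonal i j h
  have h2 : (2 : ℝ) ≤ (M i j : ℝ) := by
    have : 2 ≤ M i j := by omega
    exact_mod_cast this
  apply Real.sin_pos_of_pos_of_lt_pi
  · have := Real.pi_pos
    positivity
  · rw [div_lt_iff₀ (by linarith)]
    nlinarith [Real.pi_pos]

lemma geoRefl_liftable {B : Type*} (M : CoxeterMatrix B) : M.IsLiftable (geoRefl M) := by
  intro i j
  by_cases hij : i = j
  · subst hij
    rw [M.diagonal, pow_one]
    refine LinearMap.ext fun v => ?_
    simp only [Module.End.mul_apply, geoRefl_apply, map_sub, map_smul, geoForm_single, gram_self,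
      smul_eq_mul, Module.End.one_apply]
    module
  by_cases h0 : M i j = 0
  · rw [h0, pow_zero]
  have hs := sin_pos_of_ne M hij h0
  have hm : (M i j : ℝ) ≠ 0 := by exact_mod_cast h0
  have hfi : ((geoRefl M i * geoRefl M j) ^ (M i j)) (Finsupp.single i 1) =
      Finsupp.single i 1 := by
    have := geoRefl_pow_left M i j (M i j)
    have c1 : (2 * (M i j : ℝ) + 1) * (Real.pi / (M i j : ℝ)) =
      Real.pi / (M i j : ℝ) + 2 * Real.pi := by field_simp; ring
    have c2 : 2 * (M i j : ℝ) * (Real.pi / (M i j : ℝ)) = 2 * Real.pi := by field_simp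
    rw [c1, c2, Real.sin_add_two_pi, Real.sin_two_pi, zero_smul, add_zero] at this
    exact smul_right_injective _ hs.ne' this
  have hfj : ((geoRefl M i * geoRefl M j) ^ (M i j)) (Finsupp.single j 1) =
      Finsupp.single j 1 := by
    have := geoRefl_pow_right M i j (M i j)
    have c1 : (2 * (M i j : ℝ) - 1) * (Real.pi / (M i j : ℝ)) =
      2 * Real.pi - Real.pi / (M i j : ℝ) := by field_simp
    have c2 : 2 * (M i j : ℝ) * (Real.pi / (M i j : ℝ)) = 2 * Real.pi := by field_simp
    rw [c1, c2, Real.sin_two_pi_sub, Real.sin_two_pi] at this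
    apply smul_right_injective _ hs.ne'
    simp only [this]
    module
  have hfix : ∀ z, geoForm M i z = 0 → geoForm M j z = 0 → ∀ n : ℕ,
      ((geoRefl M i * geoRefl M j) ^ n) z = z := by
    intro z h1 h2 n
    induction n with
    | zero => simp
    | succ n ih =>
      rw [pow_succ, Module.End.mul_apply, Module.End.mul_apply, geoRefl_apply M j, h2, zero_smul,
        sub_zero, geoRefl_apply, h1, zero_smul, sub_zero, ih]
  refine LinearMap.ext fun z => ?_
  set c := Real.cos (Real.pi / (M i j : ℝ)) with hc
  set s := Real.sin (Real.pi / (M i j : ℝ)) with hsdef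
  have hsc : s ^ 2 + c ^ 2 = 1 := Real.sin_sq_add_cos_sq _
  have hg : gram M i j = -2 * c := rfl
  set a := (geoForm M i z + c * geoForm M j z) / (2 * s ^ 2) with ha
  set b := (c * geoForm M i z + geoForm M j z) / (2 * s ^ 2) with hb
  have ha' : 2 * s ^ 2 * a = geoForm M i z + c * geoForm M j z := by rw [ha]; field_simp
  have hb' : 2 * s ^ 2 * b = c * geoForm M i z + geoForm M j z := by rw [hb]; field_simp
  have hs2 : (2 * s ^ 2) ≠ 0 := by positivity
  have hz := hfix (z - (a • Finsupp.single i 1 + b • Finsupp.single j 1)) (by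
      simp only [map_sub, map_add, map_smul, geoForm_single, gram_self, smul_eq_mul, hg]
      apply mul_left_cancel₀ hs2
      linear_combination (-2) * ha' + 2 * c * hb' + 2 * geoForm M i z * hsc) (by
      simp only [map_sub, map_add, map_smul, geoForm_single, gram_self, smul_eq_mul,
        gram_symm M j i, hg]
      apply mul_left_cancel₀ hs2
      linear_combination (-2) * hb' + 2 * c * ha' + 2 * geoForm M j z * hsc) (M i j)
  rw [map_sub, map_add, map_smul, map_smul, hfi, hfj] at hz
  simpa using hz

lemma geoRefl_pow_left_infty {B : Type*} (M : CoxeterMatrix B) (i j : B) (h : M i j = 0) (n : ℕ) :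
    ((geoRefl M i * geoRefl M j) ^ n) (Finsupp.single i 1) =
      (2 * n + 1 : ℝ) • Finsupp.single i 1 + (2 * n : ℝ) • Finsupp.single j 1 := by
  have hg : gram M i j = -2 := by simp [gram, h]
  induction n with
  | zero => simp
  | succ n ih =>
    rw [pow_succ', Module.End.mul_apply, ih, map_add, map_smul, map_smul,
      geoRefl_mul_left, geoRefl_mul_right, hg]
    push_cast
    module

/-- The product of two distinct simple reflections has order exactly `M i j`. -/
lemma dvd_of_pow_eq_one {B W : Type*} [Group W] {M : CoxeterMatrix B} (cs : CoxeterSystem M W)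
    {i j : B} (hij : i ≠ j) {k : ℕ} (hk : (cs.simple i * cs.simple j) ^ k = 1) : M i j ∣ k := by
  have h1 : (geoRefl M i * geoRefl M j) ^ k = 1 := by
    have := congrArg (cs.lift ⟨geoRefl M, geoRefl_liftable M⟩) hk
    simpa using this
  by_cases h0 : M i j = 0
  · have h2 := geoRefl_pow_left_infty M i j h0 k
    rw [h1] at h2
    have h3 := DFunLike.congr_fun h2 j
    simp [Finsupp.single_apply, hij] at h3
    simp [h3]
  · have h2 := geoRefl_pow_left M i j k
    have hs := sin_pos_of_ne M hij h0
    have hm : (M i j : ℝ) ≠ 0 := by exact_mod_cast h0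
    rw [h1] at h2
    have h3 := DFunLike.congr_fun h2 j
    have h4 := DFunLike.congr_fun h2 i
    simp [Finsupp.single_apply, hij, hij.symm] at h3 h4
    rw [add_mul, one_mul, Real.sin_add, ← h3, zero_mul, zero_add] at h4
    have h5 : Real.cos (2 * k * (Real.pi / (M i j : ℝ))) = 1 :=
      mul_right_cancel₀ hs.ne' (by rw [one_mul]; exact h4.symm)
    obtain ⟨n, hn⟩ := (Real.cos_eq_one_iff _).1 h5
    have h6 : (n : ℝ) * (M i j : ℝ) = k := by
      have hpi := Real.pi_ne_zero
      field_simp at hn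
      linarith
    have h7 : n * (M i j : ℤ) = k := by exact_mod_cast h6
    exact Int.natCast_dvd_natCast.1 ⟨n, by rw [← h7, mul_comm]⟩

/-! ### The exchange condition -/

lemma end_mul_apply {X : Type*} (f g : Function.End X) (p : X) : (f * g) p = f (g p) := rfl

lemma end_one_apply {X : Type*} (p : X) : (1 : Function.End X) p = p := rfl

open Classical in
/-- The permutation action of a simple reflection on `W × ℤ/2`. -/
noncomputable def flipAct {B W : Type*} [Group W] {M : CoxeterMatrix B} (cs : CoxeterSystem M W)
    (i : B) : Function.End (W × ZMod 2) :=
  fun p => (cs.simple i * p.1 * cs.simple i, p.2 + if p.1 = cs.simple i then 1 else 0)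

open Classical in
lemma flipAct_pow {B W : Type*} [Group W] {M : CoxeterMatrix B} (cs : CoxeterSystem M W)
    (i j : B) (n : ℕ) (p : W × ZMod 2) :
    ((flipAct cs i * flipAct cs j) ^ n : Function.End (W × ZMod 2)) p =
      ((cs.simple i * cs.simple j) ^ n * p.1 * (cs.simple j * cs.simple i) ^ n,
        p.2 + ∑ k ∈ Finset.range (2 * n),
          if p.1 = (cs.simple j * cs.simple i) ^ k * cs.simple j then 1 else 0) := by
  induction n with
  | zero => simp [end_one_apply]
  | succ n ih =>
    rw [pow_succ', end_mul_apply, ih, end_mul_apply]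
    set s := cs.simple i with hs
    set t := cs.simple j with ht
    have hss : s⁻¹ = s := cs.inv_simple i
    have htt : t⁻¹ = t := cs.inv_simple j
    have hinv : (s * t)⁻¹ = t * s := by rw [mul_inv_rev, hss, htt]
    have hinvn : ((s * t) ^ n)⁻¹ = (t * s) ^ n := by rw [← inv_pow, hinv]
    have hinvn' : ((t * s) ^ n)⁻¹ = (s * t) ^ n := by rw [← hinvn, inv_inv]
    have hcomm : t * (s * t) ^ n = (t * s) ^ n * t := by
      have : SemiconjBy t (s * t) (t * s) := by simp [SemiconjBy, mul_assoc]
      exact (this.pow_right n).eq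
    have c1 : ((s * t) ^ n * p.1 * (t * s) ^ n = t) ↔ p.1 = (t * s) ^ (2 * n) * t := by
      rw [← eq_mul_inv_iff_mul_eq, ← eq_inv_mul_iff_mul_eq, hinvn, hinvn', hcomm, two_mul,
        pow_add, mul_assoc]
    have c2 : (t * ((s * t) ^ n * p.1 * (t * s) ^ n) * t = s) ↔
        p.1 = (t * s) ^ (2 * n + 1) * t := by
      rw [← eq_mul_inv_iff_mul_eq, ← eq_inv_mul_iff_mul_eq, ← eq_mul_inv_iff_mul_eq,
        ← eq_inv_mul_iff_mul_eq, hinvn, hinvn', htt]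
      have : (t * s) ^ n * (t * (s * t) * (s * t) ^ n) = (t * s) ^ (2 * n + 1) * t := by
        rw [mul_assoc t, mul_assoc s, hcomm, ← mul_assoc s, ← mul_assoc t]
        simp only [← mul_assoc, pow_succ, two_mul, pow_add]
        have : (t * s) ^ n * t * s * (t * s) ^ n = (t * s) ^ n * (t * s) ^ n * t * s := by
          rw [mul_assoc _ t s, ← pow_succ, ← pow_add, mul_assoc _ t s, ← pow_add, ← pow_succ]
          congr 1; ring
        rw [this]
      rw [← this]
    rw [show 2 * (n + 1) = 2 * n + 1 + 1 by ring, Finset.sum_range_succ, Finset.sum_range_succ]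
    simp only [flipAct, ← hs, ← ht]
    ext
    · simp only [pow_succ']
      rw [← pow_succ' (t * s), pow_succ]
      simp only [mul_assoc]
    · simp only [c1, c2, add_assoc]

lemma flipAct_liftable {B W : Type*} [Group W] {M : CoxeterMatrix B} (cs : CoxeterSystem M W) :
    M.IsLiftable (flipAct cs) := by
  classical
  intro i j
  funext p
  rw [flipAct_pow]
  rw [two_mul, Finset.sum_range_add]
  have h1 := cs.simple_mul_simple_pow i j
  have h2 := cs.simple_mul_simple_pow' i j
  simp only [pow_add, h1, h2, one_mul, mul_one]
  rw [CharTwo.add_self_eq_zero]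
  simp [end_one_apply]

open Classical in
lemma lift_flipAct_apply {B W : Type*} [Group W] {M : CoxeterMatrix B} (cs : CoxeterSystem M W)
    (l : List B) (p : W × ZMod 2) :
    cs.lift ⟨flipAct cs, flipAct_liftable cs⟩ (cs.wordProd l) p =
      (cs.wordProd l * p.1 * (cs.wordProd l)⁻¹,
        p.2 + ((cs.rightInvSeq l).count p.1 : ZMod 2)) := by
  induction l with
  | nil => simp [end_one_apply]
  | cons i l ih =>
    rw [cs.wordProd_cons, map_mul, end_mul_apply, ih,
      cs.lift_apply_simple]
    simp only [flipAct, CoxeterSystem.rightInvSeq, List.count_cons]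
    have : (cs.wordProd l * p.1 * (cs.wordProd l)⁻¹ = cs.simple i) ↔
        (cs.wordProd l)⁻¹ * cs.simple i * cs.wordProd l = p.1 := by
      constructor
      · intro h; rw [← h]; group
      · intro h; rw [← h]; group
    ext
    · simp [mul_assoc]
    · simp only [this, beq_iff_eq]
      push_cast
      rw [add_assoc]

open Classical in
lemma count_leftInvSeq_eq {B W : Type*} [Group W] {M : CoxeterMatrix B} (cs : CoxeterSystem M W)
    {l l' : List B} (h : cs.wordProd l = cs.wordProd l') (x : W) :
    ((cs.leftInvSeq l).count x : ZMod 2) = ((cs.leftInvSeq l').count x : ZMod 2) := by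
  have h1 := lift_flipAct_apply cs l.reverse (x, 0)
  have h2 := lift_flipAct_apply cs l'.reverse (x, 0)
  have h3 : cs.wordProd l.reverse = cs.wordProd l'.reverse := by simp [h]
  rw [h3, h2] at h1
  have h4 := (congrArg Prod.snd h1).symm
  simpa [cs.rightInvSeq_reverse] using h4

/-- Exchange condition. -/
lemma mem_leftInvSeq_of_descent {B W : Type*} [Group W] {M : CoxeterMatrix B}
    (cs : CoxeterSystem M W) {l : List B} {i : B}
    (h : cs.IsLeftDescent (cs.wordProd l) i) : cs.simple i ∈ cs.leftInvSeq l := by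
  classical
  obtain ⟨ω, hω, he⟩ := cs.exists_isReduced (cs.simple i * cs.wordProd l)
  have hp : cs.wordProd (i :: ω) = cs.wordProd l := by
    rw [cs.wordProd_cons, ← he, cs.simple_mul_simple_cancel_left]
  have hr : cs.IsReduced (i :: ω) := by
    have h1 := cs.isLeftDescent_iff.1 h
    rw [he, hω.eq] at h1
    rw [CoxeterSystem.IsReduced, hp, List.length_cons, h1]
  have hn := hr.nodup_leftInvSeq
  have hm : cs.simple i ∈ cs.leftInvSeq (i :: ω) := by simp [CoxeterSystem.leftInvSeq]
  have hc := List.count_eq_one_of_mem hn hm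
  have := count_leftInvSeq_eq cs hp (cs.simple i)
  rw [hc] at this
  by_contra hnot
  rw [List.count_eq_zero_of_not_mem hnot] at this
  simp at this

/-! ### Alternating words -/

/-- The alternating word `a b a ⋯` with `n` letters. -/
def altL {B : Type*} (a b : B) : ℕ → List B
  | 0 => []
  | n + 1 => a :: altL b a n

lemma length_altL {B : Type*} (a b : B) (n : ℕ) : (altL a b n).length = n := by
  induction n generalizing a b with
  | zero => rfl
  | succ n ih => simp [altL, ih]

lemma mem_leftInvSeq_altL {B W : Type*} [Group W] {M : CoxeterMatrix B}
    (cs : CoxeterSystem M W) (x y : B) (k : ℕ) (t : W) (ht : t ∈ cs.leftInvSeq (altL x y k)) :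
    ∃ i < k, t = (cs.simple x * cs.simple y) ^ i * cs.simple x := by
  induction k generalizing x y t with
  | zero => simp [altL] at ht
  | succ k ih =>
    simp only [altL, CoxeterSystem.leftInvSeq, List.mem_cons, List.mem_map] at ht
    rcases ht with rfl | ⟨u, hu, rfl⟩
    · exact ⟨0, by omega, by simp⟩
    · obtain ⟨i, hi, rfl⟩ := ih y x u hu
      refine ⟨i + 1, by omega, ?_⟩
      have : SemiconjBy (cs.simple x) (cs.simple y * cs.simple x) (cs.simple x * cs.simple y) := by
        simp [SemiconjBy, mul_assoc]
      have h2 := (this.pow_right i).eq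
      rw [MulAut.conj_apply, ← mul_assoc, h2, cs.inv_simple, pow_succ]
      simp only [mul_assoc]

lemma wordProd_altL_even {B W : Type*} [Group W] {M : CoxeterMatrix B}
    (cs : CoxeterSystem M W) (s t : B) (n : ℕ) :
    cs.wordProd (altL s t (2 * n)) = (cs.simple s * cs.simple t) ^ n := by
  induction n with
  | zero => simp [altL]
  | succ n ih =>
    rw [show 2 * (n + 1) = 2 * n + 1 + 1 by ring]
    simp only [altL, cs.wordProd_cons, ih, pow_succ', mul_assoc]

lemma wordProd_altL_comm {B W : Type*} [Group W] {M : CoxeterMatrix B}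
    (cs : CoxeterSystem M W) (s t : B) :
    cs.wordProd (altL s t (M s t)) = cs.wordProd (altL t s (M s t)) := by
  have hpow := cs.simple_mul_simple_pow s t
  have hinv : (cs.simple s * cs.simple t)⁻¹ = cs.simple t * cs.simple s := by simp
  rcases Nat.even_or_odd' (M s t) with ⟨n, hn | hn⟩
  · rw [hn] at hpow ⊢
    rw [wordProd_altL_even, wordProd_altL_even, ← hinv, inv_pow, eq_inv_iff_mul_eq_one, ← pow_add,
      ← two_mul, hpow]
  · rw [hn] at hpow ⊢
    simp only [altL, cs.wordProd_cons, wordProd_altL_even]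
    have h : (cs.simple s * cs.simple t) ^ n * (cs.simple s * cs.simple t) ^ n *
        (cs.simple s * cs.simple t) = 1 := by
      rw [← pow_add, ← two_mul, ← pow_succ, hpow]
    have h2 := eq_inv_of_mul_eq_one_left h
    rw [hinv] at h2
    have h3 : (cs.simple t * cs.simple s) ^ n = ((cs.simple s * cs.simple t) ^ n)⁻¹ := by
      rw [← hinv, inv_pow]
    rw [h3, eq_comm, ← mul_inv_eq_iff_eq_mul, inv_inv, mul_assoc, h2, ← mul_assoc]
    simp

/-- Key step: growing the alternating prefix. -/
lemma grow_alt {B W : Type*} [Group W] {M : CoxeterMatrix B} (cs : CoxeterSystem M W)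
    {s t : B} (hst : s ≠ t) {w : W} (hs : cs.IsLeftDescent w s) (ht : cs.IsLeftDescent w t)
    (k : ℕ) (hk : M s t = 0 ∨ k ≤ M s t) :
    ∃ (x y : B) (r : List B), ((x = s ∧ y = t) ∨ (x = t ∧ y = s)) ∧
      cs.wordProd (altL x y k ++ r) = w ∧ k + r.length = cs.length w := by
  induction k with
  | zero =>
    obtain ⟨ω, hω, rfl⟩ := cs.exists_isReduced w
    exact ⟨s, t, ω, Or.inl ⟨rfl, rfl⟩, by simp [altL], by rw [hω.eq]; omega⟩
  | succ k ih =>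
    obtain ⟨x, y, r, hxy, hp, hl⟩ := ih (by omega)
    have hne : x ≠ y := by
      rcases hxy with ⟨rfl, rfl⟩ | ⟨rfl, rfl⟩
      · exact hst
      · exact hst.symm
    have hM : M x y = M s t := by
      rcases hxy with ⟨rfl, rfl⟩ | ⟨rfl, rfl⟩
      · rfl
      · exact M.symmetric _ _
    have hy : cs.IsLeftDescent w y := by
      rcases hxy with ⟨rfl, rfl⟩ | ⟨rfl, rfl⟩ <;> assumption
    have hmem := mem_leftInvSeq_of_descent cs (l := altL x y k ++ r) (i := y) (by rw [hp]; exact hy)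
    obtain ⟨j, hj, hje⟩ := List.mem_iff_getElem.1 hmem
    rw [cs.length_leftInvSeq, List.length_append, length_altL] at hj
    by_cases hjk : j < k
    · exfalso
      have hmem' : cs.simple y ∈ cs.leftInvSeq (altL x y k) := by
        have h1 := cs.leftInvSeq_take (altL x y k ++ r) k
        rw [List.take_left' (length_altL x y k)] at h1
        rw [h1, ← hje]
        exact List.mem_take_iff_getElem.2 ⟨j, by simp [length_altL]; omega, rfl⟩
      obtain ⟨i, hi, he⟩ := mem_leftInvSeq_altL cs x y k _ hmem'
      have h1 : (cs.simple x * cs.simple y) ^ (i + 1) = 1 := by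
        rw [pow_succ, ← mul_assoc, ← he, cs.simple_mul_simple_self]
      have h2 := dvd_of_pow_eq_one cs hne h1
      rw [hM] at h2
      rcases hk with hk | hk
      · rw [hk, zero_dvd_iff] at h2
        omega
      · have := Nat.le_of_dvd (by omega) h2
        omega
    · have h1 := cs.getD_leftInvSeq_mul_wordProd (altL x y k ++ r) j
      rw [List.getD_eq_getElem _ _ (by simp [length_altL]; omega), hje, hp,
        List.eraseIdx_append_of_length_le (by rw [length_altL]; omega), length_altL] at h1
      refine ⟨y, x, r.eraseIdx (j - k), by tauto, ?_, ?_⟩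
      · simp only [altL, List.cons_append, cs.wordProd_cons]
        rw [← h1, cs.simple_mul_simple_cancel_left]
      · rw [List.length_eraseIdx_of_lt (by omega)]
        omega

lemma exists_alt_prefix {B W : Type*} [Group W] {M : CoxeterMatrix B} (cs : CoxeterSystem M W)
    {s t : B} (hst : s ≠ t) {w : W} (hs : cs.IsLeftDescent w s) (ht : cs.IsLeftDescent w t) :
    M s t ≠ 0 ∧ ∃ r : List B, cs.wordProd (altL s t (M s t) ++ r) = w ∧
      M s t + r.length = cs.length w := by
  have h0 : M s t ≠ 0 := by
    intro h0
    obtain ⟨x, y, r, -, -, h⟩ := grow_alt cs hst hs ht (cs.length w + 1) (Or.inl h0)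
    omega
  refine ⟨h0, ?_⟩
  obtain ⟨x, y, r, hxy, hp, hl⟩ := grow_alt cs hst hs ht (M s t) (Or.inr le_rfl)
  refine ⟨r, ?_, hl⟩
  rcases hxy with ⟨rfl, rfl⟩ | ⟨rfl, rfl⟩
  · exact hp
  · rw [cs.wordProd_append, wordProd_altL_comm, ← cs.wordProd_append, hp]

/-! ### Matsumoto's theorem -/

lemma altProd_eq {B : Type*} (M : CoxeterMatrix B) (s t : B) (n : ℕ) :
    ((altL s t n).map (σ M)).prod = altProd (σ M s) (σ M t) n := by
  induction n generalizing s t with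
  | zero => rfl
  | succ n ih => simp [altL, altProd, ih]

lemma map_altProd {G H : Type*} [Monoid G] [Monoid H] (f : G →* H) (a b : G) (n : ℕ) :
    f (altProd a b n) = altProd (f a) (f b) n := by
  induction n generalizing a b with
  | zero => simp [altProd]
  | succ n ih => simp [altProd, ih]

lemma artin_braid {B : Type*} (M : CoxeterMatrix B) (s t : B) (h : M s t ≠ 0) :
    altProd (σ M s) (σ M t) (M s t) = altProd (σ M t) (σ M s) (M s t) := by
  have h1 : PresentedGroup.mk (artinRelationsSet M)
      (altProd (FreeGroup.of s) (FreeGroup.of t) (M s t) *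
        (altProd (FreeGroup.of t) (FreeGroup.of s) (M s t))⁻¹) = 1 :=
    PresentedGroup.one_of_mem ⟨s, t, h, rfl⟩
  rw [map_mul, map_inv, mul_inv_eq_one, map_altProd, map_altProd] at h1
  exact h1

theorem matsumoto {B : Type*} (M : CoxeterMatrix B) (n : ℕ) : ∀ (l l' : List B),
    l.length = n → M.toCoxeterSystem.IsReduced l → M.toCoxeterSystem.IsReduced l' →
    M.toCoxeterSystem.wordProd l = M.toCoxeterSystem.wordProd l' →
    (l.map (σ M)).prod = (l'.map (σ M)).prod := by
  set cs := M.toCoxeterSystem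
  induction n with
  | zero =>
    intro l l' hn hl hl' h
    have h2 : l'.length = 0 := by rw [← hl'.eq, ← h, hl.eq, hn]
    rw [List.length_eq_zero_iff.1 hn, List.length_eq_zero_iff.1 h2]
  | succ n ih =>
    have same : ∀ (s : B) (l l' : List B), l.length = n → cs.IsReduced (s :: l) →
        cs.IsReduced (s :: l') → cs.wordProd (s :: l) = cs.wordProd (s :: l') →
        ((s :: l).map (σ M)).prod = ((s :: l').map (σ M)).prod := by
      intro s l l' hn hl hl' h
      have := ih l l' hn (by simpa using hl.drop 1) (by simpa using hl'.drop 1)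
        (by simpa [cs.wordProd_cons] using h)
      simp [this]
    intro l l' hn hl hl' h
    have hn' : l'.length = n + 1 := by rw [← hl'.eq, ← h, hl.eq, hn]
    obtain ⟨s, l, rfl⟩ := List.exists_cons_of_length_eq_add_one hn
    obtain ⟨t, l', rfl⟩ := List.exists_cons_of_length_eq_add_one hn'
    simp only [List.length_cons, Nat.add_right_cancel_iff] at hn hn'
    by_cases hst : s = t
    · subst hst
      exact same s l l' hn hl hl' h
    have desc : ∀ (s : B) (l : List B), cs.IsReduced (s :: l) →
        cs.IsLeftDescent (cs.wordProd (s :: l)) s := by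
      intro s l hl
      rw [CoxeterSystem.IsLeftDescent, hl.eq, cs.wordProd_cons, cs.simple_mul_simple_cancel_left]
      exact lt_of_le_of_lt (cs.length_wordProd_le l) (by simp)
    obtain ⟨h0, r, hr, hlen⟩ := exists_alt_prefix cs hst (desc s l hl) (by rw [h]; exact desc t l' hl')
    have hr' : cs.wordProd (altL t s (M s t) ++ r) = cs.wordProd (s :: l) := by
      rw [cs.wordProd_append, ← wordProd_altL_comm, ← cs.wordProd_append, hr]
    have red1 : cs.IsReduced (altL s t (M s t) ++ r) := by
      rw [CoxeterSystem.IsReduced, hr, ← hlen, List.length_append, length_altL]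
    have red2 : cs.IsReduced (altL t s (M s t) ++ r) := by
      rw [CoxeterSystem.IsReduced, hr', ← hlen, List.length_append, length_altL]
    have mid : ((altL s t (M s t) ++ r).map (σ M)).prod =
        ((altL t s (M s t) ++ r).map (σ M)).prod := by
      rw [List.map_append, List.map_append, List.prod_append, List.prod_append, altProd_eq,
        altProd_eq, artin_braid M s t h0]
    obtain ⟨m, hm⟩ := Nat.exists_eq_succ_of_ne_zero h0
    rw [hm] at hr hr' red1 red2 mid
    simp only [Nat.succ_eq_add_one, altL, List.cons_append] at hr hr' red1 red2 mid
    rw [same s l _ hn hl red1 hr.symm, mid]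
    exact (same t l' _ hn' hl' red2 (by rw [hr', h])).symm

lemma tau_aux {B : Type*} (M : CoxeterMatrix B) (l : List B)
    (hred : M.toCoxeterSystem.IsReduced l) (y y' : B)
    (hlen : ¬ M.toCoxeterSystem.IsLeftDescent (M.toCoxeterSystem.wordProd l) y)
    (h : M.simple y * M.toCoxeterSystem.wordProd l = M.toCoxeterSystem.wordProd l * M.simple y') :
    σ M y * (l.map (σ M)).prod = (l.map (σ M)).prod * σ M y' := by
  have h1 := M.toCoxeterSystem.not_isLeftDescent_iff.1 hlen
  have e : M.toCoxeterSystem.wordProd (y :: l) = M.toCoxeterSystem.wordProd (l ++ [y']) := by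
    rw [CoxeterSystem.wordProd_cons, CoxeterSystem.wordProd_append,
      CoxeterSystem.wordProd_singleton]
    exact h
  have r1 : M.toCoxeterSystem.IsReduced (y :: l) := by
    rw [CoxeterSystem.IsReduced, CoxeterSystem.wordProd_cons, h1, hred.eq, List.length_cons]
  have r2 : M.toCoxeterSystem.IsReduced (l ++ [y']) := by
    rw [CoxeterSystem.IsReduced, ← e, r1.eq]
    simp
  have := matsumoto M _ _ _ rfl r1 r2 e
  simpa using this

/-- Lemma 1 of the paper: if `w ∈ W_S` conjugates `Y₁ ⊆ S` to `Y₂ ⊆ S`, then the image of any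
reduced expression of `w` in the Artin–Tits group conjugates `σ_y` to `σ_{w⁻¹ y w}` for all
`y ∈ Y₁`. -/
theorem tau_conjugates_generators
    {B : Type*} [Finite B] (M : CoxeterMatrix B)
    (Y₁ Y₂ : Set B) (w : M.Group)
    (hw : (fun x => w⁻¹ * x * w) '' (M.simple '' Y₁) = M.simple '' Y₂)
    (l : List B) (hl : M.toCoxeterSystem.wordProd l = w)
    (hred : M.toCoxeterSystem.IsReduced l) :
    ∀ y ∈ Y₁, ∀ y' : B, w⁻¹ * M.simple y * w = M.simple y' →
      ((l.map (σ M)).prod)⁻¹ * σ M y * (l.map (σ M)).prod = σ M y' := by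
  intro y _ y' h
  have h' : M.simple y * w = w * M.simple y' := by
    rw [← h]; group
  subst hl
  rw [mul_assoc, inv_mul_eq_iff_eq_mul]
  by_cases hd : M.toCoxeterSystem.IsLeftDescent (M.toCoxeterSystem.wordProd l) y
  · obtain ⟨r, hr, he⟩ :=
      M.toCoxeterSystem.exists_isReduced (M.simple y * M.toCoxeterSystem.wordProd l)
    have hys : M.simple y * M.simple y = 1 := M.toCoxeterSystem.simple_mul_simple_self y
    have e : M.toCoxeterSystem.wordProd (y :: r) = M.toCoxeterSystem.wordProd l := by
      rw [CoxeterSystem.wordProd_cons, ← he]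
      exact M.toCoxeterSystem.simple_mul_simple_cancel_left y
    have hlen := M.toCoxeterSystem.isLeftDescent_iff.1 hd
    have hlen2 : M.toCoxeterSystem.length (M.toCoxeterSystem.wordProd r) + 1 =
        M.toCoxeterSystem.length (M.toCoxeterSystem.wordProd l) := by
      rw [← he]; exact hlen
    have hyr : M.toCoxeterSystem.IsReduced (y :: r) := by
      rw [CoxeterSystem.IsReduced, e, ← hlen2, hr.eq, List.length_cons]
    have key := tau_aux M r hr y y' (by
        have e' : M.toCoxeterSystem.simple y * M.toCoxeterSystem.wordProd r =
          M.toCoxeterSystem.wordProd l := by rw [← e, CoxeterSystem.wordProd_cons]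
        rw [CoxeterSystem.IsLeftDescent, e']
        omega) (by
        rw [← he, mul_assoc, ← h'])
    rw [← matsumoto M _ _ _ rfl hyr hred e, List.map_cons, List.prod_cons, mul_assoc, key]
  · exact tau_aux M l hred y y' hd h'

end ArtinTits
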